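/- Let n ≥ 1, let s ∈ (Fin n → ZMod 2) with s ≠ 0, and let f : (Fin n → ZMod 2) → (Fin n → ZMod 2) satisfy f x = f y if and only if (y = x or y = x + s) (so f is two-to-one and invariant under the XOR-mask s). Then for every p ∈ (Fin n → ZMod 2), the probability that Simon's quantum subroutine outputs p, namely (1/4^n) · ∑_{v ∈ range f} (∑_{x : f x = v} (-1)^{(x·p).val})² (a real number), equals 2^{1-n} if s·p = 0 and equals 0 if s·p = 1. In particular the measurement output is uniformly distributed over the set of strings orthogonal to s. -/

import Mathlib

/-- The parity sign is an additive character of `ZMod 2`. -/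
lemma neg_one_pow_val_add (a b : ZMod 2) :
    (-1 : ℝ) ^ (a + b).val = (-1) ^ a.val * (-1) ^ b.val := by
  rw [ZMod.val_add, ← neg_one_pow_eq_pow_mod_two, pow_add]

section TwoToOne

variable {n : ℕ} {s : Fin n → ZMod 2} {f : (Fin n → ZMod 2) → (Fin n → ZMod 2)}

lemma fiber_eq_pair (hf : ∀ x y, f x = f y ↔ (y = x ∨ y = x + s)) (y : Fin n → ZMod 2) :
    (Finset.univ.filter fun x => f x = f y) = {y, y + s} := by
  ext x
  simpa using eq_comm.trans (hf y x)

lemma two_mul_card_image (hs : s ≠ 0) (hf : ∀ x y, f x = f y ↔ (y = x ∨ y = x + s)) :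
    2 * (Finset.univ.image f).card = 2 ^ n := by
  have hcard := Finset.card_eq_sum_card_image f Finset.univ
  rw [Finset.sum_congr rfl (g := fun _ => 2)] at hcard
  · simpa [mul_comm] using hcard.symm
  · intro v hv
    obtain ⟨y, -, rfl⟩ := Finset.mem_image.mp hv
    rw [fiber_eq_pair hf, Finset.card_pair (by simpa using hs)]

lemma sum_sq_fiber_sign (hs : s ≠ 0) (hf : ∀ x y, f x = f y ↔ (y = x ∨ y = x + s))
    (p : Fin n → ZMod 2) :
    ∑ v ∈ Finset.univ.image f,
        (∑ x ∈ Finset.univ.filter fun x => f x = v,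
          (-1 : ℝ) ^ ((∑ i, x i * p i).val)) ^ 2 =
      (Finset.univ.image f).card * (1 + (-1) ^ (∑ i, s i * p i).val) ^ 2 := by
  rw [← nsmul_eq_mul]
  refine Finset.sum_eq_card_nsmul fun v hv => ?_
  obtain ⟨y, -, rfl⟩ := Finset.mem_image.mp hv
  rw [fiber_eq_pair hf, Finset.sum_pair (by simpa using hs)]
  simp only [Pi.add_apply, add_mul, Finset.sum_add_distrib, neg_one_pow_val_add]
  rw [← mul_one_add, mul_pow, ← pow_mul, mul_comm _ 2, pow_mul]
  simp

end TwoToOne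


/-- Simon's subroutine output distribution: for a two-to-one function invariant under the
XOR-mask `s ≠ 0`, the probability of measuring `p` equals `2^(1-n)` when `s·p = 0`
and `0` when `s·p = 1`. -/
theorem simon_subroutine_probability (n : ℕ) (hn : 1 ≤ n)
    (s : Fin n → ZMod 2) (hs : s ≠ 0)
    (f : (Fin n → ZMod 2) → (Fin n → ZMod 2))
    (hf : ∀ x y, f x = f y ↔ (y = x ∨ y = x + s))
    (p : Fin n → ZMod 2) :
    ((∑ i, s i * p i) = 0 →
        (1 / 4 ^ n : ℝ) *
            ∑ v ∈ Finset.univ.image f,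
              (∑ x ∈ Finset.univ.filter fun x => f x = v,
                  (-1 : ℝ) ^ ((∑ i, x i * p i).val)) ^ 2 =
          (2 : ℝ) ^ ((1 : ℤ) - n)) ∧
      ((∑ i, s i * p i) = 1 →
        (1 / 4 ^ n : ℝ) *
            ∑ v ∈ Finset.univ.image f,
              (∑ x ∈ Finset.univ.filter fun x => f x = v,
                  (-1 : ℝ) ^ ((∑ i, x i * p i).val)) ^ 2 = 0) := by
  rw [sum_sq_fiber_sign hs hf]
  refine ⟨fun h => ?_, fun h => ?_⟩
  · have hcard : 2 * ((Finset.univ.image f).card : ℝ) = 2 ^ n := by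
      exact_mod_cast two_mul_card_image hs hf
    have hpow : (4 : ℝ) ^ n = 2 ^ n * 2 ^ n := by rw [← mul_pow]; norm_num
    rw [h, zpow_sub₀ two_ne_zero, zpow_one, zpow_natCast, hpow]
    field_simp
    norm_num
    linarith
  · simp [h, ZMod.val_one]
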